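/- Let ψ(t) = log( (1 + e^{t+π})(1 + e^{t−π}) / (1 + e^t)² ). Then for every t ∈ ℝ the series φ(t) = Σ_{j∈ℤ} ψ(t + 2πj) converges absolutely, the convergence is uniform on compact subsets of ℝ, and the resulting function φ is 2π-periodic and real-analytic on ℝ. -/

import Mathlib

open Real Filter

/-- `ψ(t) = log((1 + e^{t+π})(1 + e^{t−π}) / (1 + e^t)²)`. -/
noncomputable def psiFun (t : ℝ) : ℝ :=
  Real.log ((1 + Real.exp (t + π)) * (1 + Real.exp (t - π)) / (1 + Real.exp t) ^ 2)

/-- The periodization `φ(t) = Σ_{j∈ℤ} ψ(t + 2πj)`. -/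
noncomputable def phiFun (t : ℝ) : ℝ := ∑' j : ℤ, psiFun (t + 2 * π * j)

noncomputable def cplxW (z : ℂ) : ℂ := ((Real.cosh π - 1 : ℝ) : ℂ) / (1 + Complex.cosh z)

noncomputable def cplxG (z : ℂ) : ℂ := Complex.log (1 + cplxW z)

lemma aux_a_pos : 0 < Real.cosh π - 1 := by
  have := Real.one_lt_cosh.2 Real.pi_ne_zero
  linarith

lemma aux_psi (t : ℝ) : ((psiFun t : ℝ) : ℂ) = cplxG t := by
  have h1 : (0:ℝ) < 1 + Real.cosh t := by have := Real.cosh_pos t; linarith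
  have hpos : 0 < 1 + (Real.cosh π - 1) / (1 + Real.cosh t) := by
    have := div_pos aux_a_pos h1
    linarith
  have key : (1 + Real.exp (t + π)) * (1 + Real.exp (t - π)) / (1 + Real.exp t) ^ 2
      = 1 + (Real.cosh π - 1) / (1 + Real.cosh t) := by
    rw [Real.cosh_eq] at h1
    rw [Real.cosh_eq, Real.cosh_eq, Real.exp_add, sub_eq_add_neg, Real.exp_add, Real.exp_neg,
      Real.exp_neg]
    rw [Real.exp_neg] at h1
    have hx := Real.exp_pos t
    have hp := Real.exp_pos π
    have h2 : 1 + (Real.exp t + (Real.exp t)⁻¹) / 2 = (1 + Real.exp t) ^ 2 / (2 * Real.exp t) := by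
      field_simp
      ring
    rw [h2]
    field_simp
    ring
  unfold psiFun cplxG cplxW
  rw [key, Complex.ofReal_log hpos.le]
  push_cast
  rfl

lemma aux_re (z : ℂ) : (Complex.cosh z).re = Real.cosh z.re * Real.cos z.im := by
  conv_lhs => rw [← Complex.re_add_im z, Complex.cosh_add, Complex.cosh_mul_I, Complex.sinh_mul_I]
  rw [← Complex.ofReal_cosh, ← Complex.ofReal_sinh, ← Complex.ofReal_cos, ← Complex.ofReal_sin]
  simp [-Complex.ofReal_cosh, -Complex.ofReal_sinh, -Complex.ofReal_cos, -Complex.ofReal_sin]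

lemma aux_cos {y : ℝ} (hy : |y| < 1) : Real.cos 1 ≤ Real.cos y := by
  rw [← Real.cos_abs y]
  exact Real.cos_le_cos_of_nonneg_of_le_pi (abs_nonneg _) (by linarith [Real.pi_gt_three]) hy.le

lemma aux_low {z : ℂ} (hz : |z.im| < 1) :
    Real.cos 1 / 2 * Real.exp |z.re| < (1 + Complex.cosh z).re := by
  have h1 := aux_cos hz
  have h2 := Real.cos_one_pos
  have h3 : Real.exp |z.re| / 2 ≤ Real.cosh z.re := by
    rw [← Real.cosh_abs, Real.cosh_eq]
    have := Real.exp_pos (-|z.re|)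
    linarith
  have h4 := Real.exp_pos |z.re|
  rw [Complex.add_re, aux_re, Complex.one_re]
  have : Real.exp |z.re| / 2 * Real.cos 1 ≤ Real.cosh z.re * Real.cos z.im := by gcongr
  linarith

lemma aux_den_pos {z : ℂ} (hz : |z.im| < 1) : 0 < (1 + Complex.cosh z).re :=
  lt_trans (mul_pos (half_pos Real.cos_one_pos) (Real.exp_pos _)) (aux_low hz)

lemma aux_den_ne {z : ℂ} (hz : |z.im| < 1) : 1 + Complex.cosh z ≠ 0 := by
  intro h
  have := aux_den_pos hz
  simp [h] at this

lemma aux_W_re {z : ℂ} (hz : |z.im| < 1) : 0 ≤ (cplxW z).re := by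
  unfold cplxW
  rw [div_eq_mul_inv, Complex.re_ofReal_mul, Complex.inv_re]
  exact mul_nonneg aux_a_pos.le (div_nonneg (aux_den_pos hz).le (Complex.normSq_nonneg _))

lemma aux_slit {w : ℂ} (hw : 0 ≤ w.re) : 1 + w ∈ Complex.slitPlane := by
  left
  simp
  linarith

lemma aux_log {w : ℂ} (hw : 0 ≤ w.re) : ‖Complex.log (1 + w)‖ ≤ ‖w‖ := by
  have hc : Convex ℝ {w : ℂ | 0 ≤ w.re} := convex_halfSpace_re_ge 0
  have := hc.norm_image_sub_le_of_norm_hasDerivWithin_le (f := fun w => Complex.log (1 + w))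
    (f' := fun w => 1 / (1 + w)) (C := 1) (x := 0) (y := w)
    (fun x hx => (((hasDerivAt_id x).const_add 1).clog (aux_slit hx)).hasDerivWithinAt)
    (fun x hx => by
      have hx' : 0 ≤ x.re := hx
      have h1 : 1 ≤ ‖1 + x‖ := by
        refine le_trans ?_ (Complex.re_le_norm _)
        simp [hx']
      rw [norm_div, norm_one]
      exact (div_le_one (by linarith)).2 h1) (show (0:ℝ) ≤ (0:ℂ).re from le_rfl) hw
  simpa using this

lemma aux_G_bound {z : ℂ} (hz : |z.im| < 1) :
    ‖cplxG z‖ ≤ (Real.cosh π - 1) / (Real.cos 1 / 2) * Real.exp (-|z.re|) := by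
  refine (aux_log (aux_W_re hz)).trans ?_
  unfold cplxW
  rw [norm_div, Complex.norm_real, Real.norm_of_nonneg aux_a_pos.le, Real.exp_neg,
    ← div_eq_mul_inv, div_div]
  have h1 := mul_pos (half_pos Real.cos_one_pos) (Real.exp_pos |z.re|)
  exact div_le_div_of_nonneg_left aux_a_pos.le h1
    ((aux_low hz).le.trans (Complex.re_le_norm _))

lemma aux_G_diff {z : ℂ} (hz : |z.im| < 1) : DifferentiableAt ℂ cplxG z := by
  unfold cplxG
  refine DifferentiableAt.clog ?_ (aux_slit (aux_W_re hz))
  unfold cplxW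
  refine (differentiableAt_const _).add ((differentiableAt_const _).div ?_ (aux_den_ne hz))
  exact (differentiableAt_const _).add Complex.differentiable_cosh.differentiableAt

noncomputable def auxU (R : ℝ) (j : ℤ) : ℝ :=
  (Real.cosh π - 1) / (Real.cos 1 / 2) * (Real.exp R * Real.exp (-|(j:ℝ)|))

lemma aux_summable (R : ℝ) : Summable (auxU R) := by
  unfold auxU
  refine Summable.mul_left _ (Summable.mul_left _ ?_)
  refine Summable.of_nat_of_neg ?_ ?_ <;> simpa using Real.summable_exp_neg_nat

lemma aux_term {R : ℝ} {z : ℂ} (hz : |z.im| < 1) (hR : |z.re| < R) (j : ℤ) :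
    ‖cplxG (z + ((2 * π * j : ℝ) : ℂ))‖ ≤ auxU R j := by
  refine (aux_G_bound (by simpa using hz)).trans ?_
  unfold auxU
  rw [← Real.exp_add]
  have hc : 0 ≤ (Real.cosh π - 1) / (Real.cos 1 / 2) :=
    (div_pos aux_a_pos (half_pos Real.cos_one_pos)).le
  refine mul_le_mul_of_nonneg_left (Real.exp_le_exp.2 ?_) hc
  rw [Complex.add_re, Complex.ofReal_re]
  have h1 : |2 * π * (j:ℝ)| = 2 * π * |(j:ℝ)| := by
    rw [abs_mul, abs_of_pos Real.two_pi_pos]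
  have h2 : |2 * π * (j:ℝ)| ≤ |z.re + 2 * π * j| + |z.re| := by
    have := abs_sub (z.re + 2 * π * j) z.re
    simpa using this
  have h3 : |(j:ℝ)| ≤ 2 * π * |(j:ℝ)| :=
    le_mul_of_one_le_left (abs_nonneg _) (by linarith [Real.pi_gt_three])
  linarith

lemma aux_real {R t : ℝ} (hR : |t| < R) (j : ℤ) : ‖psiFun (t + 2 * π * j)‖ ≤ auxU R j := by
  have := aux_term (z := (t:ℂ)) (R := R) (by simp) (by simpa using hR) j
  rwa [← Complex.ofReal_add, ← aux_psi, Complex.norm_real] at this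

lemma aux_phi (t : ℝ) : phiFun t = (∑' j : ℤ, cplxG ((t:ℂ) + ((2 * π * j : ℝ) : ℂ))).re := by
  have : (∑' j : ℤ, cplxG ((t:ℂ) + ((2 * π * j : ℝ) : ℂ))) = ((phiFun t : ℝ) : ℂ) := by
    unfold phiFun
    rw [Complex.ofReal_tsum]
    refine tsum_congr fun j => ?_
    rw [← Complex.ofReal_add, ← aux_psi]
  rw [this, Complex.ofReal_re]

/-- The periodization of `ψ` converges absolutely at every point, uniformly on compact
subsets of `ℝ`, and the resulting function `φ` is `2π`-periodic and real-analytic. -/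
theorem periodization_analytic :
    (∀ t : ℝ, Summable fun j : ℤ => |psiFun (t + 2 * π * j)|) ∧
    (∀ K : Set ℝ, IsCompact K →
      TendstoUniformlyOn (fun (s : Finset ℤ) (t : ℝ) => ∑ j ∈ s, psiFun (t + 2 * π * j))
        phiFun Filter.atTop K) ∧
    (∀ t : ℝ, phiFun (t + 2 * π) = phiFun t) ∧
    (∀ t : ℝ, AnalyticAt ℝ phiFun t) := by
  refine ⟨fun t => ?_, fun K hK => ?_, fun t => ?_, fun t => ?_⟩
  · exact Summable.of_nonneg_of_le (fun _ => abs_nonneg _)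
      (fun j => aux_real (lt_add_one |t|) j) (aux_summable (|t| + 1))
  · obtain ⟨R, hR⟩ := hK.isBounded.exists_norm_le
    exact tendstoUniformlyOn_tsum (aux_summable (R + 1))
      (fun j t ht => aux_real (lt_of_le_of_lt (hR t ht) (lt_add_one R)) j)
  · unfold phiFun
    rw [← (Equiv.addRight (1:ℤ)).tsum_eq (fun j : ℤ => psiFun (t + 2 * π * j))]
    refine tsum_congr fun j => ?_
    congr 1
    simp
    ring
  · let U : Set ℂ := {z | |z.im| < 1} ∩ {z | |z.re| < |t| + 1}
    have hU : IsOpen U :=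
      (isOpen_lt (continuous_abs.comp Complex.continuous_im) continuous_const).inter
        (isOpen_lt (continuous_abs.comp Complex.continuous_re) continuous_const)
    have htU : (t:ℂ) ∈ U := ⟨by simp, by simp⟩
    have hd : DifferentiableOn ℂ
        (fun z : ℂ => ∑' j : ℤ, cplxG (z + ((2 * π * j : ℝ) : ℂ))) U := by
      refine Complex.differentiableOn_tsum_of_summable_norm (aux_summable (|t| + 1))
        (fun j z hz => ?_) hU (fun j z hz => aux_term hz.1 hz.2 j)
      have h1 : DifferentiableAt ℂ cplxG (z + ((2 * π * j : ℝ) : ℂ)) :=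
        aux_G_diff (by simpa using hz.1)
      exact (h1.comp z (differentiableAt_id.add_const _)).differentiableWithinAt
    have ha := (hd.analyticAt (hU.mem_nhds htU)).restrictScalars (𝕜 := ℝ)
    have h2 := (Complex.reCLM.analyticAt _).comp (ha.comp (Complex.ofRealCLM.analyticAt t))
    have h3 : phiFun = fun t : ℝ => (∑' j : ℤ, cplxG ((t:ℂ) + ((2 * π * j : ℝ) : ℂ))).re :=
      funext aux_phi
    rw [h3]
    exact h2
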